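/- Let ζ > 0, γ > 0, h ≥ 0 and real constants S, μ, η, ψ, σ, ν, y_b, y_S, z_S, z_{Sb}, z_b be given, and suppose K := y_b − ψ·y_S ≥ 0. Set g* = h + K/ζ and Γ* = (y_b + η·y_S − S)/γ. Then (g*, Γ*) maximizes the Hamiltonian H(g, Γ) = −(ζ/2)((g − h)₊)² − S·Γ − (γ/2)·Γ² + y_b·(g + Γ) + y_S·(μ + η·Γ − ψ·g) + σ·z_S − ψ·ν·z_{Sb} + ν·z_b over the set {(g, Γ) : g ≥ 0, Γ ∈ ℝ}, and (g*, Γ*) satisfies the first-order conditions y_b + η·y_S − S − γ·Γ* = 0 and y_b − ψ·y_S − ζ·(g* − h)₊ = 0. -/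

import Mathlib

/-- Let ζ > 0, γ > 0, h ≥ 0 and real constants S, μ, η, ψ, σ, ν, y_b, y_S,
z_S, z_{Sb}, z_b be given, and suppose K := y_b − ψ·y_S ≥ 0.
Set g* = h + K/ζ and Γ* = (y_b + η·y_S − S)/γ.
Then (g*, Γ*) maximizes the Hamiltonian
H(g, Γ) = −(ζ/2)((g − h)₊)² − S·Γ − (γ/2)·Γ² + y_b·(g + Γ) + y_S·(μ + η·Γ − ψ·g)
          + σ·z_S − ψ·ν·z_{Sb} + ν·z_b
over the set {(g, Γ) : g ≥ 0, Γ ∈ ℝ}, and (g*, Γ*) satisfies the first-order conditions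
y_b + η·y_S − S − γ·Γ* = 0 and y_b − ψ·y_S − ζ·(g* − h)₊ = 0. -/
theorem hamiltonian_maximizer_and_foc
    (ζ γ h S μ η ψ σ ν yb yS zS zSb zb : ℝ)
    (hζ : 0 < ζ) (hγ : 0 < γ) (hh : 0 ≤ h)
    (hK : 0 ≤ yb - ψ * yS) :
    (∀ g Γ : ℝ, 0 ≤ g →
      -(ζ / 2) * (max (g - h) 0) ^ 2 - S * Γ - γ / 2 * Γ ^ 2
          + yb * (g + Γ) + yS * (μ + η * Γ - ψ * g) + σ * zS - ψ * ν * zSb + ν * zb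
        ≤ -(ζ / 2) * (max ((h + (yb - ψ * yS) / ζ) - h) 0) ^ 2
            - S * ((yb + η * yS - S) / γ) - γ / 2 * ((yb + η * yS - S) / γ) ^ 2
            + yb * ((h + (yb - ψ * yS) / ζ) + (yb + η * yS - S) / γ)
            + yS * (μ + η * ((yb + η * yS - S) / γ) - ψ * (h + (yb - ψ * yS) / ζ))
            + σ * zS - ψ * ν * zSb + ν * zb) ∧
    yb + η * yS - S - γ * ((yb + η * yS - S) / γ) = 0 ∧
    yb - ψ * yS - ζ * max ((h + (yb - ψ * yS) / ζ) - h) 0 = 0 := by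
  have hk : ζ * ((yb - ψ * yS) / ζ) = yb - ψ * yS := by field_simp
  have hG : γ * ((yb + η * yS - S) / γ) = yb + η * yS - S := by field_simp
  have hk0 : 0 ≤ (yb - ψ * yS) / ζ := div_nonneg hK hζ.le
  generalize (yb - ψ * yS) / ζ = k at *
  generalize (yb + η * yS - S) / γ = G at *
  have hmax : max (h + k - h) 0 = k := by
    rw [add_sub_cancel_left]
    exact max_eq_left hk0
  rw [hmax]
  refine ⟨?_, by linarith, by linarith⟩
  intro g Γ _
  have hp : g - h ≤ max (g - h) 0 := le_max_left _ _
  generalize max (g - h) 0 = p at *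
  have h1 : 0 ≤ ζ / 2 * (k - p) ^ 2 := by positivity
  have h2 : 0 ≤ γ / 2 * (Γ - G) ^ 2 := by positivity
  have h3 : 0 ≤ (yb - ψ * yS) * (p - (g - h)) := mul_nonneg hK (by linarith)
  obtain rfl : yb = ζ * k + ψ * yS := by linarith
  obtain rfl : S = ζ * k + ψ * yS + η * yS - γ * G := by linarith
  linarith
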